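/- For every θ ∈ (0,1), M > 0, and 0 < v₀ ≤ v₁, there exists a constant c > 0, depending only on θ, M, v₀, v₁, with the following property. For every nonempty finite type K, every symmetric c : K → K → ℝ with c x y ≥ 0, every κ : K → ℝ with κ x ≥ θ for all x, the associated ferromagnetic Gaussian Gibbs measure μ satisfying v₀ ≤ ∫ (φ x)² dμ(φ) ≤ v₁ for all x ∈ K, every increasing set A ⊆ (K → Bool), and every h ∈ (−M, M): −(deriv of the function h ↦ (μ(A^h)).toReal at h) ≥ c · Σ_{x∈K} I_μ(A^h, x). (Proposition 4.3, equation (4.8).) -/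

import Mathlib

open MeasureTheory Real

/-- The level-set event `A^h = {φ | (1{h ≤ φ x})_x ∈ A}`. -/
def levSet {K : Type} (A : Set (K → Bool)) (h : ℝ) : Set (K → ℝ) :=
  {φ | (fun x => decide (h ≤ φ x)) ∈ A}

/-- The conditional influence `I_μ(A^h, x)`. -/
noncomputable def condInfl {K : Type} (μ : Measure (K → ℝ))
    (A : Set (K → Bool)) (h : ℝ) (x : K) : ℝ :=
  (μ (levSet A h ∩ {φ | h ≤ φ x})).toReal / (μ {φ : K → ℝ | h ≤ φ x}).toReal
    - (μ (levSet A h ∩ {φ | φ x < h})).toReal / (μ {φ : K → ℝ | φ x < h}).toReal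

/-- Two-point form of the four functions inequality. -/
lemma ENNReal.add_le_add_of_mul_le_mul {a b c d : ENNReal} (ha : a ≤ c) (hb : b ≤ c)
    (hab : a * b ≤ c * d) : a + b ≤ c + d := by
  rcases eq_or_ne c ⊤ with rfl | hc
  · simp
  rcases eq_or_ne d ⊤ with rfl | hd
  · simp
  lift c to NNReal using hc
  lift d to NNReal using hd
  lift a to NNReal using ne_top_of_le_ne_top ENNReal.coe_ne_top ha
  lift b to NNReal using ne_top_of_le_ne_top ENNReal.coe_ne_top hb
  norm_cast at *
  rw [← NNReal.coe_le_coe] at *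
  push_cast at *
  rcases (c.coe_nonneg).eq_or_lt with h | h
  · linarith [d.coe_nonneg]
  · refine le_of_mul_le_mul_left ?_ h
    nlinarith [mul_nonneg (sub_nonneg.2 ha) (sub_nonneg.2 hb)]

/-- The four functions inequality on a linear order. -/
lemma lintegral_mul_lintegral_le_of_sup_inf {α : Type*} [MeasurableSpace α] [LinearOrder α]
    (μ : Measure α) [SFinite μ] {f₁ f₂ f₃ f₄ : α → ENNReal}
    (h₁ : Measurable f₁) (h₂ : Measurable f₂) (h₃ : Measurable f₃) (h₄ : Measurable f₄)
    (H : ∀ x y, f₁ x * f₂ y ≤ f₃ (x ⊔ y) * f₄ (x ⊓ y)) :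
    (∫⁻ x, f₁ x ∂μ) * (∫⁻ x, f₂ x ∂μ) ≤ (∫⁻ x, f₃ x ∂μ) * (∫⁻ x, f₄ x ∂μ) := by
  have key (f g : α → ENNReal) (hf : Measurable f) (hg : Measurable g) :
      2 * ((∫⁻ x, f x ∂μ) * (∫⁻ x, g x ∂μ))
        = ∫⁻ z : α × α, (f z.1 * g z.2 + f z.2 * g z.1) ∂(μ.prod μ) := by
    rw [lintegral_add_left (by fun_prop), lintegral_prod_mul hf.aemeasurable hg.aemeasurable,
      two_mul]
    congr 1
    rw [← lintegral_prod_mul hf.aemeasurable hg.aemeasurable]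
    exact (lintegral_prod_swap (fun z : α × α => f z.1 * g z.2)).symm
  have two (x y : α) (hxy : x ≤ y) :
      f₁ x * f₂ y + f₁ y * f₂ x ≤ f₃ y * f₄ x + f₃ x * f₄ y := by
    refine ENNReal.add_le_add_of_mul_le_mul (by simpa [hxy] using H x y)
      (by simpa [hxy] using H y x) ?_
    calc f₁ x * f₂ y * (f₁ y * f₂ x) = (f₁ x * f₂ x) * (f₁ y * f₂ y) := by ring
      _ ≤ (f₃ x * f₄ x) * (f₃ y * f₄ y) := by
        exact mul_le_mul' (by simpa using H x x) (by simpa using H y y)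
      _ = _ := by ring
  rw [← ENNReal.mul_le_mul_iff_right two_ne_zero ENNReal.ofNat_ne_top, key _ _ h₁ h₂,
    key _ _ h₃ h₄]
  refine lintegral_mono fun z => ?_
  rcases le_total z.1 z.2 with h | h
  · refine (two _ _ h).trans_eq (add_comm _ _)
  · exact (add_comm _ _).trans_le (two _ _ h)

/-- The four functions inequality on a finite power of a linear order. -/
lemma lintegral_pi_mul_lintegral_pi_le_of_sup_inf {ι α : Type*} [Fintype ι] [MeasurableSpace α]
    [LinearOrder α] (μ : ι → Measure α) [∀ i, SigmaFinite (μ i)]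
    {f₁ f₂ f₃ f₄ : (ι → α) → ENNReal}
    (h₁ : Measurable f₁) (h₂ : Measurable f₂) (h₃ : Measurable f₃) (h₄ : Measurable f₄)
    (H : ∀ x y, f₁ x * f₂ y ≤ f₃ (x ⊔ y) * f₄ (x ⊓ y)) :
    (∫⁻ x, f₁ x ∂Measure.pi μ) * (∫⁻ x, f₂ x ∂Measure.pi μ)
      ≤ (∫⁻ x, f₃ x ∂Measure.pi μ) * (∫⁻ x, f₄ x ∂Measure.pi μ) := by
  classical
  have marginal (s : Finset ι) : ∀ x y, lmarginal μ s f₁ x * lmarginal μ s f₂ y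
      ≤ lmarginal μ s f₃ (x ⊔ y) * lmarginal μ s f₄ (x ⊓ y) := by
    induction s using Finset.induction with
    | empty => simpa using H
    | insert i s hi ih =>
      intro x y
      rw [lmarginal_insert _ h₁ hi, lmarginal_insert _ h₂ hi, lmarginal_insert _ h₃ hi,
        lmarginal_insert _ h₄ hi]
      refine lintegral_mul_lintegral_le_of_sup_inf (μ i)
        ((h₁.lmarginal μ).comp (measurable_update x))
        ((h₂.lmarginal μ).comp (measurable_update y))
        ((h₃.lmarginal μ).comp (measurable_update (x ⊔ y)))
        ((h₄.lmarginal μ).comp (measurable_update (x ⊓ y))) fun a b => ?_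
      have hsup : Function.update (x ⊔ y) i (a ⊔ b)
          = Function.update x i a ⊔ Function.update y i b := by
        ext j; by_cases h : j = i
        · subst h; simp
        · simp [h]
      have hinf : Function.update (x ⊓ y) i (a ⊓ b)
          = Function.update x i a ⊓ Function.update y i b := by
        ext j; by_cases h : j = i
        · subst h; simp
        · simp [h]
      rw [hsup, hinf]
      exact ih _ _
  rcases isEmpty_or_nonempty (ι → α) with h | ⟨⟨x⟩⟩
  · simp [lintegral_of_isEmpty]
  · simpa using marginal Finset.univ x x

section Gaussian
open ProbabilityTheory

/-- A random variable with centred Gaussian exponential moments is Gaussian. -/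
lemma map_eq_gaussianReal_of_lintegral_exp {Ω : Type*} [MeasurableSpace Ω] {P : Measure Ω}
    [IsProbabilityMeasure P] {X : Ω → ℝ} (hX : Measurable X) (v : NNReal)
    (h : ∀ t : ℝ, ∫⁻ ω, ENNReal.ofReal (exp (t * X ω)) ∂P = ENNReal.ofReal (exp (v * t ^ 2 / 2))) :
    P.map X = gaussianReal 0 v := by
  have hmgf : mgf X P = mgf id (gaussianReal 0 v) := by
    ext t
    rw [mgf_id_gaussianReal, mgf, integral_eq_lintegral_of_nonneg_ae
      (ae_of_all _ fun _ => (exp_pos _).le) (by fun_prop), h,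
      ENNReal.toReal_ofReal (exp_pos _).le]
    simp
  have hset : integrableExpSet X P = Set.univ := by
    rw [integrableExpSet_eq_of_mgf hmgf, integrableExpSet_id_gaussianReal]
  have := Measure.ext_of_complexMGF_eq (μ' := gaussianReal 0 v) hX.aemeasurable aemeasurable_id
    (funext fun z => eqOn_complexMGF_of_mgf hmgf (by simp [hset]))
  simpa using this

lemma integral_indicator_Ici_mul_gaussianReal {v : NNReal} (hv : v ≠ 0) (h : ℝ) :
    ∫ x, (Set.Ici h).indicator 1 x * x ∂gaussianReal 0 v
      = √(v / (2 * π)) * exp (-h ^ 2 / (2 * v)) := by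
  have hv0 : (0 : ℝ) < v := by positivity
  have hderiv (x : ℝ) : HasDerivAt (fun x => -(v * gaussianPDFReal 0 v x))
      (gaussianPDFReal 0 v x * x) x := by
    unfold gaussianPDFReal
    have := (((((hasDerivAt_id x).sub_const 0).pow 2).neg.div_const (2 * (v : ℝ))).exp.const_mul
      (√(2 * π * v))⁻¹).const_mul (v : ℝ) |>.neg
    refine this.congr_deriv ?_
    simp only [id_eq, sub_zero]
    field_simp
    simp [neg_div]
    ring
  have hint : Integrable (fun x => gaussianPDFReal 0 v x * x) := by
    have := (memLp_id_gaussianReal (μ := 0) (v := v) 1).integrable (by simp)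
    rw [gaussianReal_of_var_ne_zero _ hv, integrable_withDensity_iff_integrable_smul'
      (measurable_gaussianPDF _ _) (ae_of_all _ fun _ => gaussianPDF_lt_top)] at this
    simpa [toReal_gaussianPDF] using this
  have hlim : Filter.Tendsto (fun x => -(v * gaussianPDFReal 0 v x)) Filter.atTop (nhds 0) := by
    have hexp : Filter.Tendsto (fun x : ℝ => exp (-(x ^ 2 / (2 * v)))) Filter.atTop (nhds 0) :=
      tendsto_exp_neg_atTop_nhds_zero.comp
        ((Filter.tendsto_pow_atTop two_ne_zero).atTop_div_const (by positivity))
    simpa [gaussianPDFReal, neg_div, mul_assoc] using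
      (hexp.const_mul (v * (√(2 * π * v))⁻¹)).neg
  have := integral_Ioi_of_hasDerivAt_of_tendsto' (fun x (_ : x ∈ Set.Ici h) => hderiv x)
    hint.integrableOn hlim
  rw [integral_gaussianReal_eq_integral_smul hv]
  calc _ = ∫ x, (Set.Ici h).indicator (fun x => gaussianPDFReal 0 v x * x) x := by
        congr with x
        by_cases hx : x ∈ Set.Ici h <;> simp [hx]
    _ = ∫ x in Set.Ioi h, gaussianPDFReal 0 v x * x := by
        rw [integral_indicator measurableSet_Ici, integral_Ici_eq_integral_Ioi]
    _ = v * gaussianPDFReal 0 v h := by rw [this]; ring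
    _ = _ := by
        have : (v : ℝ) * (√(2 * π * v))⁻¹ = √(v / (2 * π)) := by
          rw [eq_comm, Real.sqrt_eq_iff_mul_self_eq (by positivity) (by positivity)]
          field_simp
          rw [Real.sq_sqrt (by positivity)]
        rw [gaussianPDFReal, ← mul_assoc, this]; simp
end Gaussian

section Gibbs

variable {K : Type} [Fintype K]

/-- The Gibbs measure with density proportional to `exp (-B φ φ / 2)`. -/
noncomputable def gibbs (B : LinearMap.BilinForm ℝ (K → ℝ)) : Measure (K → ℝ) :=
  volume.withDensity fun φ => ENNReal.ofReal (exp (-(B φ φ) / 2) / ∫ ψ, exp (-(B ψ ψ) / 2))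

variable (B : LinearMap.BilinForm ℝ (K → ℝ))

@[fun_prop]
lemma measurable_bilinForm_self : Measurable fun φ => B φ φ := by
  have h : Continuous fun φ => B.toContinuousBilinearMap φ φ := by fun_prop
  exact h.measurable

@[fun_prop]
lemma measurable_bilinForm_left (u : K → ℝ) : Measurable fun φ => B φ u := by
  have h : Continuous fun φ => B.toContinuousBilinearMap φ u := by fun_prop
  exact h.measurable

lemma lintegral_gibbs {f : (K → ℝ) → ENNReal} (hf : Measurable f) :
    ∫⁻ φ, f φ ∂gibbs B
      = ∫⁻ φ, ENNReal.ofReal (exp (-(B φ φ) / 2) / ∫ ψ, exp (-(B ψ ψ) / 2)) * f φ := by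
  rw [gibbs, lintegral_withDensity_eq_lintegral_mul _ (by fun_prop) hf]
  rfl

lemma isProbabilityMeasure_gibbs (hB : Integrable fun φ => exp (-(B φ φ) / 2)) :
    IsProbabilityMeasure (gibbs B) := by
  have hZ : 0 < ∫ ψ, exp (-(B ψ ψ) / 2) := integral_exp_pos hB
  refine ⟨?_⟩
  rw [gibbs, withDensity_apply _ MeasurableSet.univ, Measure.restrict_univ,
    ← ofReal_integral_eq_lintegral_ofReal (hB.div_const _) (ae_of_all _ fun _ => by positivity),
    integral_div, div_self hZ.ne', ENNReal.ofReal_one]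

/-- The Cameron–Martin formula for translations of a Gibbs measure. -/
lemma lintegral_gibbs_sub (hsymm : ∀ φ ψ, B φ ψ = B ψ φ) (u : K → ℝ)
    {f : (K → ℝ) → ENNReal} (hf : Measurable f) :
    ∫⁻ φ, f (φ - u) ∂gibbs B
      = ∫⁻ φ, f φ * ENNReal.ofReal (exp (-(B φ u) - B u u / 2)) ∂gibbs B := by
  have hf' : Measurable fun φ => f (φ - u) := hf.comp (measurable_id.sub_const u)
  rw [lintegral_gibbs B hf', lintegral_gibbs B (by fun_prop),
    ← lintegral_add_right_eq_self _ u]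
  refine lintegral_congr fun φ => ?_
  rw [add_sub_cancel_right, mul_comm (f φ), ← mul_assoc]
  rw [← ENNReal.ofReal_mul' (exp_pos _).le, div_mul_eq_mul_div, ← exp_add]
  congr 4
  simp only [map_add, LinearMap.add_apply, hsymm u φ]
  ring

lemma lintegral_exp_gibbs (hsymm : ∀ φ ψ, B φ ψ = B ψ φ)
    (hB : Integrable fun φ => exp (-(B φ φ) / 2)) (u : K → ℝ) (t : ℝ) :
    ∫⁻ φ, ENNReal.ofReal (exp (t * B φ u)) ∂gibbs B
      = ENNReal.ofReal (exp (B u u * t ^ 2 / 2)) := by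
  have := isProbabilityMeasure_gibbs B hB
  have h := lintegral_gibbs_sub B hsymm (-(t • u)) (measurable_const (a := (1 : ENNReal)))
  simp only [one_mul, lintegral_const, measure_univ, mul_one] at h
  have h' (φ : K → ℝ) : ENNReal.ofReal (exp (t * B φ u)) =
      ENNReal.ofReal (exp (B u u * t ^ 2 / 2)) *
      ENNReal.ofReal (exp (-(B φ (-(t • u))) - B (-(t • u)) (-(t • u)) / 2)) := by
    rw [← ENNReal.ofReal_mul (exp_pos _).le, ← exp_add]
    congr 2
    simp
    ring
  simp_rw [h']
  rw [lintegral_const_mul _ (by fun_prop), ← h, mul_one]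

lemma map_gibbs (hsymm : ∀ φ ψ, B φ ψ = B ψ φ)
    (hB : Integrable fun φ => exp (-(B φ φ) / 2)) (u : K → ℝ) (hu : 0 ≤ B u u) :
    (gibbs B).map (fun φ => B φ u) = ProbabilityTheory.gaussianReal 0 (B u u).toNNReal := by
  have := isProbabilityMeasure_gibbs B hB
  refine map_eq_gaussianReal_of_lintegral_exp (by fun_prop) _ fun t => ?_
  rw [lintegral_exp_gibbs B hsymm hB, Real.coe_toNNReal _ hu]

lemma integrable_exp_gibbs (hsymm : ∀ φ ψ, B φ ψ = B ψ φ)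
    (hB : Integrable fun φ => exp (-(B φ φ) / 2)) (u : K → ℝ) (t : ℝ) :
    Integrable (fun φ => exp (t * B φ u)) (gibbs B) := by
  refine ⟨by fun_prop, ?_⟩
  rw [hasFiniteIntegral_iff_ofReal (ae_of_all _ fun _ => (exp_pos _).le),
    lintegral_exp_gibbs B hsymm hB]
  exact ENNReal.ofReal_lt_top

lemma measurableSet_levSet (A : Set (K → Bool)) (h : ℝ) : MeasurableSet (levSet A h) := by
  have : Measurable fun (φ : K → ℝ) (x : K) => decide (h ≤ φ x) := by
    refine measurable_pi_lambda _ fun x => ?_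
    refine measurable_to_bool ?_
    have : MeasurableSet {φ : K → ℝ | h ≤ φ x} :=
      measurableSet_le measurable_const (measurable_pi_apply x)
    convert this using 1
    ext; simp
  exact this A.toFinite.measurableSet

lemma hasDerivAt_gibbs_levSet (hsymm : ∀ φ ψ, B φ ψ = B ψ φ)
    (hB : Integrable fun φ => exp (-(B φ φ) / 2)) (A : Set (K → Bool)) (h : ℝ) :
    HasDerivAt (fun h' => (gibbs B (levSet A h')).toReal)
      (-∫ φ in levSet A h, B φ 1 ∂gibbs B) h := by
  have hexp (t : ℝ) := integrable_exp_gibbs B hsymm hB 1 t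
  have hshift (s : ℝ) : (gibbs B (levSet A (h + s))).toReal = exp (-(s ^ 2 * B 1 1) / 2) *
      ProbabilityTheory.mgf (fun φ => B φ 1) ((gibbs B).restrict (levSet A h)) (-s) := by
    have hind : Measurable ((levSet A h).indicator (1 : (K → ℝ) → ENNReal)) :=
      measurable_one.indicator (measurableSet_levSet A h)
    have hsub := lintegral_gibbs_sub B hsymm (s • 1) hind
    have hl : ∫⁻ φ, (levSet A h).indicator (1 : (K → ℝ) → ENNReal) (φ - s • (1 : K → ℝ)) ∂gibbs B
        = gibbs B (levSet A (h + s)) := by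
      rw [← lintegral_indicator_one (measurableSet_levSet A (h + s))]
      refine lintegral_congr fun φ => ?_
      have hφ : φ - s • (1 : K → ℝ) = fun x => φ x - s :=
        funext fun x => congrArg (φ x - ·) (mul_one s)
      have hmem : φ - s • (1 : K → ℝ) ∈ levSet A h ↔ φ ∈ levSet A (h + s) := by
        rw [hφ]
        simp only [levSet, Set.mem_ofPred_eq, le_sub_iff_add_le]
      by_cases hA : φ ∈ levSet A (h + s)
      · rw [Set.indicator_of_mem hA, Set.indicator_of_mem (hmem.2 hA)]
        rfl
      · rw [Set.indicator_of_notMem hA, Set.indicator_of_notMem (mt hmem.1 hA)]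
    have hr : ∫⁻ φ, (levSet A h).indicator (1 : (K → ℝ) → ENNReal) φ *
          ENNReal.ofReal (exp (-(B φ (s • 1)) - B (s • 1) (s • 1) / 2)) ∂gibbs B
        = ∫⁻ φ in levSet A h,
          ENNReal.ofReal (exp (-(s ^ 2 * B 1 1) / 2) * exp (-s * B φ 1)) ∂gibbs B := by
      rw [← lintegral_indicator (measurableSet_levSet A h)]
      refine lintegral_congr fun φ => ?_
      by_cases hφ : φ ∈ levSet A h
      · simp only [hφ, Set.indicator_of_mem, Pi.one_apply, one_mul, ← exp_add]
        congr 2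
        simp
        ring
      · simp [hφ]
    rw [hl, hr] at hsub
    rw [hsub, ProbabilityTheory.mgf, ← integral_const_mul,
      integral_eq_lintegral_of_nonneg_ae (ae_of_all _ fun _ => by positivity) (by fun_prop)]
  have hset : ProbabilityTheory.integrableExpSet (fun φ => B φ 1)
      ((gibbs B).restrict (levSet A h)) = Set.univ :=
    Set.eq_univ_of_forall fun t => (hexp t).integrableOn
  have hmgf := ProbabilityTheory.hasDerivAt_mgf (X := fun φ => B φ 1)
    (μ := (gibbs B).restrict (levSet A h)) (t := -0) (by simp [hset])
  have hmgf' := hmgf.comp (0 : ℝ) (hasDerivAt_neg (0 : ℝ))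
  have hgauss : HasDerivAt (fun s : ℝ => exp (-(s ^ 2 * B 1 1) / 2)) 0 0 := by
    have := (((hasDerivAt_pow 2 (0 : ℝ)).mul_const (B 1 1)).neg.div_const 2).exp
    simpa using this
  have hmul := hgauss.mul hmgf'
  have hsum : HasDerivAt (fun s => (gibbs B (levSet A (h + s))).toReal)
      (-∫ φ in levSet A h, B φ 1 ∂gibbs B) 0 := by
    simp_rw [hshift]
    refine hmul.congr_deriv ?_
    simp
  have := HasDerivAt.comp_sub_const (f := fun s => (gibbs B (levSet A (h + s))).toReal)
    h h (by simpa using hsum)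
  simpa using this

/-- The four functions inequality for a Gibbs measure with submodular energy. -/
lemma integral_gibbs_mul_le_of_sup_inf (hB : Integrable fun φ => exp (-(B φ φ) / 2))
    (hsub : ∀ φ ψ, B (φ ⊔ ψ) (φ ⊔ ψ) + B (φ ⊓ ψ) (φ ⊓ ψ) ≤ B φ φ + B ψ ψ)
    {f₁ f₂ f₃ f₄ : (K → ℝ) → ℝ}
    (h₁ : Measurable f₁) (h₂ : Measurable f₂) (h₃ : Measurable f₃) (h₄ : Measurable f₄)
    (p₁ : 0 ≤ f₁) (p₂ : 0 ≤ f₂) (p₃ : 0 ≤ f₃) (p₄ : 0 ≤ f₄)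
    (i₃ : Integrable f₃ (gibbs B)) (i₄ : Integrable f₄ (gibbs B))
    (H : ∀ x y, f₁ x * f₂ y ≤ f₃ (x ⊔ y) * f₄ (x ⊓ y)) :
    (∫ x, f₁ x ∂gibbs B) * (∫ x, f₂ x ∂gibbs B)
      ≤ (∫ x, f₃ x ∂gibbs B) * (∫ x, f₄ x ∂gibbs B) := by
  have hZ : 0 < ∫ ψ, exp (-(B ψ ψ) / 2) := integral_exp_pos hB
  have key := lintegral_pi_mul_lintegral_pi_le_of_sup_inf (fun _ : K => (volume : Measure ℝ))
    (f₁ := fun φ => ENNReal.ofReal (exp (-(B φ φ) / 2) / ∫ ψ, exp (-(B ψ ψ) / 2)) *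
      ENNReal.ofReal (f₁ φ))
    (f₂ := fun φ => ENNReal.ofReal (exp (-(B φ φ) / 2) / ∫ ψ, exp (-(B ψ ψ) / 2)) *
      ENNReal.ofReal (f₂ φ))
    (f₃ := fun φ => ENNReal.ofReal (exp (-(B φ φ) / 2) / ∫ ψ, exp (-(B ψ ψ) / 2)) *
      ENNReal.ofReal (f₃ φ))
    (f₄ := fun φ => ENNReal.ofReal (exp (-(B φ φ) / 2) / ∫ ψ, exp (-(B ψ ψ) / 2)) *
      ENNReal.ofReal (f₄ φ))
    (by fun_prop) (by fun_prop) (by fun_prop) (by fun_prop) ?_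
  · rw [← volume_pi, ← lintegral_gibbs B (by fun_prop), ← lintegral_gibbs B (by fun_prop),
      ← lintegral_gibbs B (by fun_prop), ← lintegral_gibbs B (by fun_prop)] at key
    simp only [integral_eq_lintegral_of_nonneg_ae (ae_of_all _ p₁) h₁.aestronglyMeasurable,
      integral_eq_lintegral_of_nonneg_ae (ae_of_all _ p₂) h₂.aestronglyMeasurable,
      integral_eq_lintegral_of_nonneg_ae (ae_of_all _ p₃) h₃.aestronglyMeasurable,
      integral_eq_lintegral_of_nonneg_ae (ae_of_all _ p₄) h₄.aestronglyMeasurable,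
      ← ENNReal.toReal_mul]
    exact ENNReal.toReal_mono (ENNReal.mul_ne_top i₃.lintegral_lt_top.ne i₄.lintegral_lt_top.ne)
      key
  · intro x y
    have hw (φ : K → ℝ) : 0 ≤ exp (-(B φ φ) / 2) / ∫ ψ, exp (-(B ψ ψ) / 2) := by positivity
    rw [← ENNReal.ofReal_mul (hw x), ← ENNReal.ofReal_mul (hw y),
      ← ENNReal.ofReal_mul (hw (x ⊔ y)), ← ENNReal.ofReal_mul (hw (x ⊓ y)),
      ← ENNReal.ofReal_mul (mul_nonneg (hw x) (p₁ x)),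
      ← ENNReal.ofReal_mul (mul_nonneg (hw _) (p₃ _))]
    refine ENNReal.ofReal_le_ofReal ?_
    rw [mul_mul_mul_comm, mul_mul_mul_comm _ (f₃ _)]
    refine mul_le_mul ?_ (H x y) (mul_nonneg (p₁ x) (p₂ y)) (by positivity)
    rw [div_mul_div_comm, div_mul_div_comm, ← exp_add, ← exp_add]
    refine div_le_div_of_nonneg_right (exp_le_exp.2 ?_) (by positivity)
    linarith [hsub x y]

end Gibbs

section Covariance
open ProbabilityTheory

lemma levSet_mono {K : Type} {A : Set (K → Bool)}
    (hA : ∀ ω ω' : K → Bool, ω ∈ A → (∀ y, ω y ≤ ω' y) → ω' ∈ A) {h : ℝ} {φ ψ : K → ℝ}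
    (hφ : φ ∈ levSet A h) (hle : φ ≤ ψ) : ψ ∈ levSet A h := by
  refine hA _ _ hφ fun y => ?_
  simp only [Bool.le_iff_imp, decide_eq_true_eq]
  exact fun hy => hy.trans (hle y)

variable {K : Type} [Fintype K]

/-- The covariance of an increasing level-set event with a Gaussian coordinate dominates the
conditional influence of that coordinate, which is nonnegative. -/
lemma condInfl_nonneg_and_mul_le (B : LinearMap.BilinForm ℝ (K → ℝ))
    (hB : Integrable fun φ => exp (-(B φ φ) / 2))
    (hsub : ∀ φ ψ, B (φ ⊔ ψ) (φ ⊔ ψ) + B (φ ⊓ ψ) (φ ⊓ ψ) ≤ B φ φ + B ψ ψ)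
    {A : Set (K → Bool)} (hA : ∀ ω ω' : K → Bool, ω ∈ A → (∀ y, ω y ≤ ω' y) → ω' ∈ A)
    {x : K} {v : NNReal} (hv : v ≠ 0)
    (hx : (gibbs B).map (fun φ => φ x) = gaussianReal 0 v) (h : ℝ) :
    0 ≤ condInfl (gibbs B) A h x ∧
      condInfl (gibbs B) A h x * (√(v / (2 * π)) * exp (-h ^ 2 / (2 * v)))
        ≤ ∫ φ in levSet A h, φ x ∂gibbs B := by
  have := isProbabilityMeasure_gibbs B hB
  set μ := gibbs B
  have hX : Measurable fun φ : K → ℝ => φ x := measurable_pi_apply x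
  set U := levSet A h
  set Y : Set (K → ℝ) := {φ | h ≤ φ x}
  set N : Set (K → ℝ) := {φ | φ x < h}
  have mU : MeasurableSet U := measurableSet_levSet A h
  have mY : MeasurableSet Y := measurableSet_le measurable_const hX
  have mN : MeasurableSet N := measurableSet_lt hX measurable_const
  have hNY : N = Yᶜ := by ext φ; simp [N, Y]
  have hsup {φ ψ : K → ℝ} (hφ : φ ∈ U) : φ ⊔ ψ ∈ U := levSet_mono hA hφ le_sup_left
  have iX : Integrable (fun φ : K → ℝ => φ x) μ := by
    have := (memLp_id_gaussianReal (μ := 0) (v := v) 1).integrable (by simp)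
    rw [← hx] at this
    exact this.comp_measurable hX
  let F : (K → ℝ) → ℝ := fun φ => max (φ x - h) 0
  let G : (K → ℝ) → ℝ := fun φ => max (h - φ x) 0
  have mF : Measurable F := (hX.sub_const h).max measurable_const
  have mG : Measurable G := (hX.const_sub h).max measurable_const
  have F0 : 0 ≤ F := fun φ => le_max_right _ _
  have G0 : 0 ≤ G := fun φ => le_max_right _ _
  have iF : Integrable F μ := (iX.sub (integrable_const h)).pos_part
  have iG : Integrable G μ := ((integrable_const h).sub iX).pos_part
  have FG (φ : K → ℝ) : F φ - G φ = φ x - h := by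
    simp only [F, G]
    rcases le_total h (φ x) with hh | hh
    · rw [max_eq_left (by linarith), max_eq_right (by linarith)]; ring
    · rw [max_eq_right (by linarith), max_eq_left (by linarith)]; ring
  have ind (S : Set (K → ℝ)) (hS : MeasurableSet S) :
      Measurable (S.indicator (1 : (K → ℝ) → ℝ)) ∧ 0 ≤ S.indicator (1 : (K → ℝ) → ℝ) ∧
      Integrable (S.indicator (1 : (K → ℝ) → ℝ)) μ ∧
      ∫ φ, S.indicator (1 : (K → ℝ) → ℝ) φ ∂μ = (μ S).toReal :=
    ⟨measurable_one.indicator hS, Set.indicator_nonneg fun _ _ => zero_le_one,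
      (integrable_const (1 : ℝ)).indicator hS, integral_indicator_one hS⟩
  obtain ⟨mU₁, pU₁, iU₁, eU₁⟩ := ind (U ∩ Y) (mU.inter mY)
  obtain ⟨mU₂, pU₂, iU₂, eU₂⟩ := ind (U ∩ N) (mU.inter mN)
  obtain ⟨mY₁, pY₁, iY₁, eY₁⟩ := ind Y mY
  obtain ⟨mN₁, pN₁, iN₁, eN₁⟩ := ind N mN
  have k₁ := integral_gibbs_mul_le_of_sup_inf B hB hsub mU₁ mF (mF.indicator mU) mY₁ pU₁ F0
    (Set.indicator_nonneg fun φ _ => F0 φ) pY₁ (iF.indicator mU) iY₁ (by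
      intro φ ψ
      by_cases hφ : φ ∈ U ∩ Y
      · rcases lt_or_ge (ψ x) h with hψ | hψ
        · have : F ψ = 0 := max_eq_right (by linarith)
          rw [this, mul_zero]
          exact mul_nonneg (Set.indicator_nonneg (fun φ _ => F0 φ) _) (pY₁ _)
        · have hinf : φ ⊓ ψ ∈ Y := le_inf (α := ℝ) hφ.2 hψ
          rw [Set.indicator_of_mem hφ, Set.indicator_of_mem hinf,
            Set.indicator_of_mem (hsup hφ.1), Pi.one_apply, Pi.one_apply, one_mul, mul_one]
          exact max_le_max_right _ (sub_le_sub_right (le_sup_right (α := ℝ)) _)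
      · rw [Set.indicator_of_notMem hφ, zero_mul]
        exact mul_nonneg (Set.indicator_nonneg (fun φ _ => F0 φ) _) (pY₁ _))
  have k₂ := integral_gibbs_mul_le_of_sup_inf B hB hsub (mG.indicator mU) mN₁ mU₂ mG
    (Set.indicator_nonneg fun φ _ => G0 φ) pN₁ pU₂ G0 iU₂ iG (by
      intro φ ψ
      by_cases hφ : φ ∈ U
      · by_cases hψ : ψ ∈ N
        · rcases lt_or_ge (φ x) h with hφ' | hφ'
          · have hmem : φ ⊔ ψ ∈ U ∩ N := ⟨hsup hφ, sup_lt_iff (α := ℝ).2 ⟨hφ', hψ⟩⟩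
            rw [Set.indicator_of_mem hφ, Set.indicator_of_mem hψ, Set.indicator_of_mem hmem,
              Pi.one_apply, Pi.one_apply, one_mul, mul_one]
            exact max_le_max_right _ (sub_le_sub_left (inf_le_left (α := ℝ)) _)
          · have : G φ = 0 := max_eq_right (by linarith)
            rw [Set.indicator_of_mem hφ, this, zero_mul]
            exact mul_nonneg (pU₂ _) (G0 _)
        · rw [Set.indicator_of_notMem hψ, mul_zero]
          exact mul_nonneg (pU₂ _) (G0 _)
      · rw [Set.indicator_of_notMem hφ, zero_mul]
        exact mul_nonneg (pU₂ _) (G0 _))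
  have k₃ := integral_gibbs_mul_le_of_sup_inf B hB hsub mU₂ mY₁ mU₁ mN₁ pU₂ pY₁ pU₁ pN₁ iU₁ iN₁ (by
      intro φ ψ
      by_cases hφ : φ ∈ U ∩ N
      · by_cases hψ : ψ ∈ Y
        · have hs : φ ⊔ ψ ∈ U ∩ Y := ⟨hsup hφ.1, le_sup_of_le_right (α := ℝ) hψ⟩
          have hi : φ ⊓ ψ ∈ N := inf_lt_of_left_lt (α := ℝ) hφ.2
          rw [Set.indicator_of_mem hφ, Set.indicator_of_mem hψ, Set.indicator_of_mem hs,
            Set.indicator_of_mem hi]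
          rfl
        · rw [Set.indicator_of_notMem hψ, mul_zero]
          exact mul_nonneg (pU₁ _) (pN₁ _)
      · rw [Set.indicator_of_notMem hφ, zero_mul]
        exact mul_nonneg (pU₁ _) (pN₁ _))
  rw [eU₁, eY₁] at k₁
  rw [eU₂, eN₁] at k₂
  rw [eU₁, eU₂, eN₁, eY₁] at k₃
  rw [integral_indicator mU] at k₁ k₂
  have mean : ∫ φ, φ x ∂μ = 0 := by
    have := integral_map (μ := μ) hX.aemeasurable (f := fun y : ℝ => y) (by fun_prop)
    rw [← this, hx, integral_id_gaussianReal]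
  have upper : ∫ φ, F φ ∂μ + h * (μ Y).toReal = √(v / (2 * π)) * exp (-h ^ 2 / (2 * v)) := by
    have hm : Measurable fun y : ℝ => (Set.Ici h).indicator 1 y * y :=
      (measurable_one.indicator measurableSet_Ici).mul measurable_id
    rw [← integral_indicator_Ici_mul_gaussianReal hv h, ← hx, integral_map hX.aemeasurable
      hm.aestronglyMeasurable,
      ← eY₁, ← integral_const_mul, ← integral_add iF (iY₁.const_mul h)]
    refine integral_congr_ae (ae_of_all _ fun φ => ?_)
    by_cases hφ : h ≤ φ x
    · simp [F, Y, hφ]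
    · simp [F, Y, hφ, (not_le.1 hφ).le]
  have hF : ∫ φ, F φ ∂μ - ∫ φ, G φ ∂μ = -h := by
    rw [← integral_sub iF iG]
    simp_rw [FG]
    rw [integral_sub iX (integrable_const h), mean]
    simp
  have hUX : ∫ φ in U, F φ ∂μ - ∫ φ in U, G φ ∂μ = ∫ φ in U, φ x ∂μ - h * (μ U).toReal := by
    rw [← integral_sub iF.integrableOn iG.integrableOn]
    simp_rw [FG]
    rw [integral_sub iX.integrableOn (integrable_const h).integrableOn]
    simp [Measure.real, mul_comm]
  have hU : (μ U).toReal = (μ (U ∩ Y)).toReal + (μ (U ∩ N)).toReal := by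
    rw [hNY, ← Set.sdiff_eq]
    exact (measureReal_inter_add_sdiff (μ := μ) mY).symm
  have hpq : (μ Y).toReal + (μ N).toReal = 1 := by
    rw [hNY]
    exact probReal_add_probReal_compl mY
  have pos (S : Set ℝ) (hS : MeasurableSet S) (hvol : volume S ≠ 0) :
      0 < (μ ((fun φ : K → ℝ => φ x) ⁻¹' S)).toReal := by
    rw [← Measure.map_apply hX hS, hx]
    exact ENNReal.toReal_pos (fun h0 => hvol (gaussianReal_absolutelyContinuous' 0 hv h0))
      (measure_ne_top _ _)
  have hp : 0 < (μ Y).toReal := pos (Set.Ici h) measurableSet_Ici (by simp)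
  have hq : 0 < (μ N).toReal := pos (Set.Iio h) measurableSet_Iio (by simp)
  rw [← upper]
  change 0 ≤ (μ (U ∩ Y)).toReal / (μ Y).toReal - (μ (U ∩ N)).toReal / (μ N).toReal ∧
    ((μ (U ∩ Y)).toReal / (μ Y).toReal - (μ (U ∩ N)).toReal / (μ N).toReal) * _ ≤ _
  constructor
  · rw [sub_nonneg, div_le_div_iff₀ hq hp]
    exact k₃
  · have e₁ : (μ (U ∩ Y)).toReal / (μ Y).toReal * (∫ φ, F φ ∂μ + h * (μ Y).toReal)
        = (μ (U ∩ Y)).toReal * (∫ φ, F φ ∂μ) / (μ Y).toReal + h * (μ (U ∩ Y)).toReal := by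
      field_simp
    have e₂ : (μ (U ∩ N)).toReal / (μ N).toReal * (∫ φ, F φ ∂μ + h * (μ Y).toReal)
        = (μ (U ∩ N)).toReal * (∫ φ, G φ ∂μ) / (μ N).toReal - h * (μ (U ∩ N)).toReal := by
      have : ∫ φ, F φ ∂μ + h * (μ Y).toReal = ∫ φ, G φ ∂μ - h * (μ N).toReal := by
        linear_combination hF + h * hpq
      rw [this]
      field_simp
    have l₁ := (div_le_iff₀ hp).2 k₁
    have l₂ := (le_div_iff₀ hq).2 k₂
    rw [sub_mul, e₁, e₂]
    rw [hU] at hUX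
    linarith

end Covariance

section Energy

variable {K : Type} [Fintype K]

/-- The bilinear form polarizing the energy with conductances `c` and killing `κ`. -/
noncomputable def energyForm (c : K → K → ℝ) (κ : K → ℝ) : LinearMap.BilinForm ℝ (K → ℝ) :=
  LinearMap.mk₂ ℝ
    (fun φ ψ => (1 / 2) * ∑ x, ∑ y, c x y * (φ y - φ x) * (ψ y - ψ x) + ∑ x, κ x * φ x * ψ x)
    (fun φ φ' ψ => by
      simp only [Pi.add_apply, add_sub_add_comm, mul_add, add_mul, Finset.sum_add_distrib]; ring)
    (fun a φ ψ => by
      simp only [Pi.smul_apply, smul_eq_mul, mul_add, Finset.mul_sum]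
      exact congrArg₂ (· + ·)
        (Finset.sum_congr rfl fun x _ => Finset.sum_congr rfl fun y _ => by ring)
        (Finset.sum_congr rfl fun x _ => by ring))
    (fun φ ψ ψ' => by
      simp only [Pi.add_apply, add_sub_add_comm, mul_add, Finset.sum_add_distrib]; ring)
    (fun a φ ψ => by
      simp only [Pi.smul_apply, smul_eq_mul, mul_add, Finset.mul_sum]
      exact congrArg₂ (· + ·)
        (Finset.sum_congr rfl fun x _ => Finset.sum_congr rfl fun y _ => by ring)
        (Finset.sum_congr rfl fun x _ => by ring))

variable (c : K → K → ℝ) (κ : K → ℝ)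

lemma energyForm_apply (φ ψ : K → ℝ) : energyForm c κ φ ψ
    = (1 / 2) * ∑ x, ∑ y, c x y * (φ y - φ x) * (ψ y - ψ x) + ∑ x, κ x * φ x * ψ x := rfl

lemma energyForm_self (φ : K → ℝ) : energyForm c κ φ φ
    = (1 / 2) * ∑ x, ∑ y, c x y * (φ y - φ x) ^ 2 + ∑ x, κ x * (φ x) ^ 2 := by
  simp only [energyForm_apply, mul_assoc, sq]

lemma energyForm_symm (φ ψ : K → ℝ) : energyForm c κ φ ψ = energyForm c κ ψ φ := by
  simp only [energyForm_apply, mul_right_comm]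

lemma energyForm_one (φ : K → ℝ) : energyForm c κ φ 1 = ∑ x, κ x * φ x := by
  simp [energyForm_apply]

variable {c κ}

lemma energyForm_sup_add_inf_le (hc : ∀ x y, 0 ≤ c x y) (φ ψ : K → ℝ) :
    energyForm c κ (φ ⊔ ψ) (φ ⊔ ψ) + energyForm c κ (φ ⊓ ψ) (φ ⊓ ψ)
      ≤ energyForm c κ φ φ + energyForm c κ ψ ψ := by
  have edge (a b a' b' : ℝ) :
      (max a b - max a' b') ^ 2 + (min a b - min a' b') ^ 2 ≤ (a - a') ^ 2 + (b - b') ^ 2 := by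
    rcases le_total a b with h | h <;> rcases le_total a' b' with h' | h' <;> simp [h, h'] <;>
      nlinarith [mul_nonneg (sub_nonneg.2 h) (sub_nonneg.2 h')]
  have site (a b : ℝ) : max a b ^ 2 + min a b ^ 2 = a ^ 2 + b ^ 2 := by
    rcases le_total a b with h | h <;> simp [h, add_comm]
  simp only [energyForm_self, Pi.sup_apply, Pi.inf_apply]
  rw [add_add_add_comm, add_add_add_comm _ _ (1 / 2 * ∑ x, ∑ y, c x y * (ψ y - ψ x) ^ 2),
    ← mul_add, ← mul_add]
  simp only [← Finset.sum_add_distrib, ← mul_add, site]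
  refine add_le_add_left (mul_le_mul_of_nonneg_left (Finset.sum_le_sum fun x _ =>
    Finset.sum_le_sum fun y _ => mul_le_mul_of_nonneg_left (edge _ _ _ _) (hc x y))
    (by norm_num)) _

lemma mul_sum_sq_le_energyForm {θ : ℝ} (hc : ∀ x y, 0 ≤ c x y) (hκ : ∀ x, θ ≤ κ x) (φ : K → ℝ) :
    θ * ∑ x, φ x ^ 2 ≤ energyForm c κ φ φ := by
  rw [energyForm_self, Finset.mul_sum]
  have h₁ : 0 ≤ ∑ x, ∑ y, c x y * (φ y - φ x) ^ 2 :=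
    Finset.sum_nonneg fun x _ => Finset.sum_nonneg fun y _ => mul_nonneg (hc x y) (sq_nonneg _)
  have h₂ : ∑ x, θ * φ x ^ 2 ≤ ∑ x, κ x * φ x ^ 2 :=
    Finset.sum_le_sum fun x _ => mul_le_mul_of_nonneg_right (hκ x) (sq_nonneg _)
  linarith

lemma integrable_exp_neg_energyForm {θ : ℝ} (hθ : 0 < θ) (hc : ∀ x y, 0 ≤ c x y)
    (hκ : ∀ x, θ ≤ κ x) : Integrable fun φ => exp (-(energyForm c κ φ φ) / 2) := by
  have hprod : Integrable fun φ : K → ℝ => ∏ x, exp (-(θ / 2) * φ x ^ 2) :=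
    Integrable.fintype_prod (f := fun (_ : K) (t : ℝ) => exp (-(θ / 2) * t ^ 2))
      fun _ => integrable_exp_neg_mul_sq (by positivity)
  refine hprod.mono' (by fun_prop) (ae_of_all _ fun φ => ?_)
  rw [Real.norm_of_nonneg (exp_pos _).le, ← exp_sum, exp_le_exp, ← Finset.mul_sum]
  linarith [mul_sum_sq_le_energyForm hc hκ φ]

/-- Evaluation at a site is represented by the energy form. -/
lemma exists_energyForm_eq_apply {θ : ℝ} (hθ : 0 < θ) (hc : ∀ x y, 0 ≤ c x y)
    (hκ : ∀ x, θ ≤ κ x) (x : K) : ∃ u, ∀ φ, energyForm c κ φ u = φ x := by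
  have hinj : Function.Injective (energyForm c κ) := by
    refine (injective_iff_map_eq_zero _).2 fun φ hφ => ?_
    have h := mul_sum_sq_le_energyForm hc hκ φ
    rw [hφ, LinearMap.zero_apply] at h
    have hsum : ∑ x, φ x ^ 2 = 0 :=
      le_antisymm (nonpos_of_mul_nonpos_right h hθ) (Finset.sum_nonneg fun x _ => sq_nonneg _)
    ext y
    simpa using (Finset.sum_eq_zero_iff_of_nonneg fun x _ => sq_nonneg (φ x)).1 hsum y
      (Finset.mem_univ y)
  obtain ⟨u, hu⟩ := (LinearMap.injective_iff_surjective_of_finrank_eq_finrank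
    Subspace.dual_finrank_eq.symm).1 hinj (LinearMap.proj x)
  refine ⟨u, fun φ => ?_⟩
  rw [energyForm_symm, hu]
  rfl

end Energy

/-- **Domination of the ℓ¹-norm of influences by the derivative**
(Proposition 4.3, eq. (4.8)): `−(d/dh) μ(A^h) ≥ c · Σ_x I_μ(A^h, x)`,
with `c = c(θ, M, v₀, v₁) > 0`. -/
theorem derivative_dominates_influences
    (θ M v₀ v₁ : ℝ) (hθ : θ ∈ Set.Ioo (0 : ℝ) 1) (hM : 0 < M)
    (hv₀ : 0 < v₀) (hv : v₀ ≤ v₁) :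
    ∃ c₁ : ℝ, 0 < c₁ ∧
      ∀ (K : Type) [Fintype K] [Nonempty K]
        (c : K → K → ℝ), (∀ x y, c x y = c y x) → (∀ x y, 0 ≤ c x y) →
        ∀ κ : K → ℝ, (∀ x, θ ≤ κ x) →
        ∀ E : (K → ℝ) → ℝ,
          (∀ φ : K → ℝ,
            E φ = (1 / 2) * ∑ x, ∑ y, c x y * (φ y - φ x) ^ 2 + ∑ x, κ x * (φ x) ^ 2) →
        ∀ Z : ℝ, Z = (∫ φ : K → ℝ, Real.exp (-(E φ) / 2)) →
        ∀ μ : Measure (K → ℝ),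
          μ = volume.withDensity (fun φ => ENNReal.ofReal (Real.exp (-(E φ) / 2) / Z)) →
        (∀ x : K, v₀ ≤ (∫ φ : K → ℝ, (φ x) ^ 2 ∂μ) ∧ (∫ φ : K → ℝ, (φ x) ^ 2 ∂μ) ≤ v₁) →
        ∀ A : Set (K → Bool),
          (∀ ω ω' : K → Bool, ω ∈ A → (∀ y, ω y ≤ ω' y) → ω' ∈ A) →
        ∀ h : ℝ, h ∈ Set.Ioo (-M) M →
          c₁ * ∑ x : K, condInfl μ A h x
            ≤ -(deriv (fun h' : ℝ => (μ (levSet A h')).toReal) h) := by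
  refine ⟨θ * (√(v₀ / (2 * π)) * exp (-M ^ 2 / (2 * v₀))),
    mul_pos hθ.1 (by positivity), ?_⟩
  intro K _ _ c _ hc κ hκ E hE Z hZ μ hμ hvar A hA h hh
  obtain rfl : E = fun φ => energyForm c κ φ φ :=
    funext fun φ => (hE φ).trans (energyForm_self c κ φ).symm
  obtain rfl : μ = gibbs (energyForm c κ) := by rw [hμ, hZ]; rfl
  have hint := integrable_exp_neg_energyForm hθ.1 hc hκ
  have hsymm := energyForm_symm c κ
  have hprob := isProbabilityMeasure_gibbs _ hint
  have coord (x : K) : 0 ≤ condInfl (gibbs (energyForm c κ)) A h x ∧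
      condInfl (gibbs (energyForm c κ)) A h x * (√(v₀ / (2 * π)) * exp (-M ^ 2 / (2 * v₀)))
        ≤ ∫ φ in levSet A h, φ x ∂gibbs (energyForm c κ) := by
    obtain ⟨u, hu⟩ := exists_energyForm_eq_apply hθ.1 hc hκ x
    have hpos : 0 ≤ energyForm c κ u u :=
      (mul_nonneg hθ.1.le (Finset.sum_nonneg fun x _ => sq_nonneg _)).trans
        (mul_sum_sq_le_energyForm hc hκ u)
    have hmap := map_gibbs _ hsymm hint u hpos
    simp_rw [hu] at hmap
    rw [hu] at hpos
    have hv₀' : v₀ ≤ ((u x).toNNReal : ℝ) := by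
      have hsq : ∫ φ, φ x ^ 2 ∂gibbs (energyForm c κ) = ((u x).toNNReal : ℝ) := by
        have h₁ := integral_map (μ := gibbs (energyForm c κ))
          (measurable_pi_apply x).aemeasurable (f := fun y : ℝ => y ^ 2) (by fun_prop)
        have h₂ := ProbabilityTheory.variance_fun_id_gaussianReal (μ := 0) (v := (u x).toNNReal)
        rw [ProbabilityTheory.variance_of_integral_eq_zero (by fun_prop) (by simp)] at h₂
        rw [← h₂, ← hmap, h₁]
      exact hsq ▸ (hvar x).1
    have hne : (u x).toNNReal ≠ 0 := by
      intro h0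
      rw [h0] at hv₀'
      exact absurd hv₀' (not_le.2 hv₀)
    obtain ⟨h0, hle⟩ := condInfl_nonneg_and_mul_le _ hint (energyForm_sup_add_inf_le hc) hA hne
      hmap h
    refine ⟨h0, le_trans (mul_le_mul_of_nonneg_left ?_ h0) hle⟩
    have hsq : h ^ 2 ≤ M ^ 2 := sq_le_sq' hh.1.le hh.2.le
    gcongr ?_ * ?_
    · gcongr
    · rw [exp_le_exp, neg_div, neg_div, neg_le_neg_iff]
      gcongr
  rw [(hasDerivAt_gibbs_levSet _ hsymm hint A h).deriv, neg_neg]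
  simp_rw [energyForm_one]
  have hcoord (x : K) : Integrable (fun φ : K → ℝ => φ x) (gibbs (energyForm c κ)) := by
    by_contra hni
    have hsq : ¬Integrable (fun φ : K → ℝ => φ x ^ 2) (gibbs (energyForm c κ)) := fun hi =>
      hni (((memLp_two_iff_integrable_sq
        (measurable_pi_apply x).aestronglyMeasurable).2 hi).integrable one_le_two)
    have := (hvar x).1
    rw [integral_undef hsq] at this
    linarith
  rw [integral_finsetSum _ fun x _ => ((hcoord x).const_mul (κ x)).integrableOn,
    Finset.mul_sum]
  refine Finset.sum_le_sum fun x _ => ?_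
  rw [integral_const_mul]
  obtain ⟨h0, hle⟩ := coord x
  calc _ = θ * (condInfl (gibbs (energyForm c κ)) A h x *
        (√(v₀ / (2 * π)) * exp (-M ^ 2 / (2 * v₀)))) := by ring
    _ ≤ _ := mul_le_mul (hκ x) hle (mul_nonneg h0 (by positivity)) (hθ.1.le.trans (hκ x))
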